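/- Let p be an odd prime and let n1, n2 be positive integers with n1 + 2·n2 = p. Then f^{1,2}(n1,n2,p) = (−1)^{n2}·(C(p−n2, n2) + C(p−n2−1, n2−1)). -/

import Mathlib

open Finset

/-- `Acount p i1 i2 n1 n2 i` is the number of pairs `(X1, X2)` of disjoint subsets of
the nonzero residues mod `p` with `|X1| = n1`, `|X2| = n2` and
`i1·ΣX1 + i2·ΣX2 = i` in `ℤ/p`. -/
def Acount (p : ℕ) [NeZero p] (i1 i2 n1 n2 : ℕ) (i : ZMod p) : ℕ :=
  (((((Finset.univ.erase (0 : ZMod p)).powersetCard n1) ×ˢ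
      ((Finset.univ.erase (0 : ZMod p)).powersetCard n2)).filter
    (fun X => X.1 ∩ X.2 = ∅ ∧
      (i1 : ZMod p) * X.1.sum id + (i2 : ZMod p) * X.2.sum id = i))).card

/-- `Δ^{i1,i2}(n1,n2,p) = A_0^{i1,i2}(n1,n2,p) - A_1^{i1,i2}(n1,n2,p)`, extended by the
convention that it vanishes when `n1 < 0`, `n2 < 0` or `n1 + n2 ≥ p`. -/
def DeltaExt (p : ℕ) [NeZero p] (i1 i2 : ℕ) (n1 n2 : ℤ) : ℤ :=
  if 0 ≤ n1 ∧ 0 ≤ n2 ∧ n1 + n2 < p then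
    (Acount p i1 i2 n1.toNat n2.toNat 0 : ℤ) - (Acount p i1 i2 n1.toNat n2.toNat 1 : ℤ)
  else 0

/-- The force `f^{i1,i2}(n1,n2,p) = Δ(n1,n2) + Δ(n1-1,n2) + Δ(n1,n2-1)`. -/
def force (p : ℕ) [NeZero p] (i1 i2 : ℕ) (n1 n2 : ℤ) : ℤ :=
  DeltaExt p i1 i2 n1 n2 + DeltaExt p i1 i2 (n1 - 1) n2 + DeltaExt p i1 i2 n1 (n2 - 1)

open Polynomial in
/-- Two bivariate complex polynomials with the same values are equal. -/
theorem bivariate_funext {P Q : ℂ[X][X]}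
    (h : ∀ x y : ℂ, (P.map (evalRingHom x)).eval y = (Q.map (evalRingHom x)).eval y) :
    P = Q := by
  ext1 n
  refine Polynomial.funext fun x => ?_
  have h' := congrArg (fun R : ℂ[X] => R.coeff n) (Polynomial.funext (h x))
  simpa using h'

open Polynomial in
/-- The power sums `a ^ n + b ^ n` as polynomials in `x = -(a + b)` and `y = a * b`. -/
noncomputable def powerSumPoly : ℕ → ℂ[X][X]
  | 0 => 2
  | 1 => -(C X : ℂ[X][X])
  | n + 2 => -(C X * powerSumPoly (n + 1)) - X * powerSumPoly n

open Polynomial in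
theorem eval_powerSumPoly (a b : ℂ) (n : ℕ) :
    ((powerSumPoly n).map (evalRingHom (-(a + b)))).eval (a * b) = a ^ n + b ^ n := by
  induction n using Nat.strong_induction_on with
  | _ n ih =>
    match n with
    | 0 => norm_num [powerSumPoly]
    | 1 => simp [powerSumPoly]
    | n + 2 =>
      have h1 := ih (n + 1) (by omega)
      have h0 := ih n (by omega)
      simp only [powerSumPoly, Polynomial.map_sub, Polynomial.map_neg, Polynomial.map_mul,
        map_C, map_X, eval_sub, eval_neg, eval_mul, eval_C, eval_X, h1, h0, coe_evalRingHom]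
      ring

/-- The absolute values of the coefficients of `powerSumPoly`. -/
def lucasCoeff (i : ℕ) : ℕ → ℕ
  | 0 => if i = 0 then 2 else 1
  | j + 1 => (i + j + 1).choose (j + 1) + (i + j).choose j

theorem lucasCoeff_succ_succ (i j : ℕ) :
    lucasCoeff (i + 1) (j + 1) = lucasCoeff i (j + 1) + lucasCoeff (i + 1) j := by
  cases j with
  | zero => simp [lucasCoeff]
  | succ j =>
    simp only [lucasCoeff]
    have h1 := Nat.choose_succ_succ (i + j + 2) (j + 1)
    have h2 := Nat.choose_succ_succ (i + j + 1) j
    have e1 : i + 1 + (j + 1) + 1 = i + j + 2 + 1 := by ring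
    have e2 : i + 1 + (j + 1) = i + j + 1 + 1 := by ring
    have e3 : i + (j + 1) + 1 = i + j + 2 := by ring
    have e4 : i + (j + 1) = i + j + 1 := by ring
    have e5 : i + 1 + j + 1 = i + j + 2 := by ring
    have e6 : i + 1 + j = i + j + 1 := by ring
    rw [e1, e2, e3, e4, e5, e6]
    simp only [Nat.succ_eq_add_one] at h1 h2
    omega

theorem coeff_powerSumPoly (n i j : ℕ) (h : i + 2 * j = n) :
    ((powerSumPoly n).coeff j).coeff i = (-1) ^ (i + j) * (lucasCoeff i j : ℂ) := by
  induction n using Nat.strong_induction_on generalizing i j with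
  | _ n ih =>
    match n, i, j, h with
    | 0, i, j, h =>
      obtain ⟨rfl, rfl⟩ : i = 0 ∧ j = 0 := by omega
      simp [powerSumPoly, lucasCoeff]
    | 1, i, j, h =>
      obtain ⟨rfl, rfl⟩ : i = 1 ∧ j = 0 := by omega
      simp [powerSumPoly, lucasCoeff]
    | n + 2, 0, 0, h => omega
    | n + 2, i + 1, 0, h =>
      have h1 := ih (n + 1) (by omega) i 0 (by omega)
      have hi : i ≠ 0 := by omega
      simp [powerSumPoly, h1, lucasCoeff, hi, pow_succ]
    | n + 2, 0, j + 1, h =>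
      have h0 := ih n (by omega) 0 j (by omega)
      have hj : lucasCoeff 0 (j + 1) = lucasCoeff 0 j := by
        cases j <;> simp [lucasCoeff]
      simp [powerSumPoly, h0, hj, pow_succ]
    | n + 2, i + 1, j + 1, h =>
      have h1 := ih (n + 1) (by omega) i (j + 1) (by omega)
      have h0 := ih n (by omega) (i + 1) j (by omega)
      simp only [powerSumPoly, Polynomial.coeff_sub, Polynomial.coeff_neg, Polynomial.coeff_C_mul,
        Polynomial.coeff_X_mul, h1, h0, lucasCoeff_succ_succ]
      push_cast
      ring

theorem prod_one_sub_mul_stdAddChar (p : ℕ) [NeZero p] (a : ℂ) :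
    ∏ k : ZMod p, (1 - a * ZMod.stdAddChar k) = 1 - a ^ p := by
  have hprim : IsPrimitiveRoot (Complex.exp (2 * Real.pi * Complex.I / p)) p :=
    Complex.isPrimitiveRoot_exp p (NeZero.ne p)
  have himage : Finset.univ.image (fun k : ZMod p => ZMod.stdAddChar (N := p) k) =
      Polynomial.nthRootsFinset p (1 : ℂ) := by
    refine Finset.eq_of_subset_of_card_le ?_ ?_
    · intro z hz
      obtain ⟨k, -, rfl⟩ := Finset.mem_image.1 hz
      rw [Polynomial.mem_nthRootsFinset (NeZero.pos p), ← AddChar.map_nsmul_eq_pow]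
      simp
    · rw [hprim.card_nthRootsFinset, Finset.card_image_of_injective _ ZMod.injective_stdAddChar]
      simp [ZMod.card]
  have h := hprim.pow_sub_pow_eq_prod_sub_mul 1 a (NeZero.pos p)
  rw [one_pow, ← himage, Finset.prod_image fun x _ y _ h => ZMod.injective_stdAddChar h] at h
  rw [h]
  exact Finset.prod_congr rfl fun k _ => by ring

open Polynomial in
/-- The factor `1 + x ψ(k) + y ψ(2k)` for the standard additive character `ψ`. -/
noncomputable def charFactor (p : ℕ) [NeZero p] (k : ZMod p) : ℂ[X][X] :=
  1 + C (C (ZMod.stdAddChar k) * X) + C (C (ZMod.stdAddChar (2 * k))) * X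

open Polynomial in
theorem prod_charFactor (p : ℕ) [NeZero p] :
    ∏ k : ZMod p, charFactor p k = 1 - powerSumPoly p + X ^ p := by
  refine bivariate_funext fun x y => ?_
  obtain ⟨a, b, rfl, rfl⟩ : ∃ a b : ℂ, x = -(a + b) ∧ y = a * b := by
    obtain ⟨a, ha⟩ := IsAlgClosed.exists_root (X ^ 2 + C x * X + C y : ℂ[X]) (by
      rw [show (X ^ 2 + C x * X + C y : ℂ[X]) = C 1 * X ^ 2 + C x * X + C y by simp,
        degree_quadratic one_ne_zero]
      norm_num)
    simp only [IsRoot.def, eval_add, eval_pow, eval_mul, eval_X, eval_C] at ha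
    exact ⟨a, -x - a, by ring, by linear_combination ha⟩
  have hfactor (k : ZMod p) :
      ((charFactor p k).map (evalRingHom (-(a + b)))).eval (a * b) =
        (1 - a * ZMod.stdAddChar k) * (1 - b * ZMod.stdAddChar k) := by
    simp only [charFactor, two_mul, AddChar.map_add_eq_mul, Polynomial.map_add,
      Polynomial.map_mul, Polynomial.map_one, map_C, map_X, eval_add, eval_mul, eval_one, eval_C,
      eval_X, coe_evalRingHom]
    ring
  rw [Polynomial.map_prod, eval_prod]
  simp only [hfactor, Finset.prod_mul_distrib, prod_one_sub_mul_stdAddChar, Polynomial.map_add,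
    Polynomial.map_sub, Polynomial.map_one, Polynomial.map_pow, map_X, eval_add, eval_sub,
    eval_one, eval_pow, eval_X, eval_powerSumPoly]
  ring

theorem Acount_eq_of_ne_zero (p : ℕ) [Fact p.Prime] (i1 i2 n1 n2 : ℕ) (i : ZMod p) (hi : i ≠ 0) :
    Acount p i1 i2 n1 n2 i = Acount p i1 i2 n1 n2 1 := by
  have hinj (c : ZMod p) (hc : c ≠ 0) : Function.Injective (fun x : ZMod p => c * x) :=
    mul_right_injective₀ hc
  have hmaps (c j : ZMod p) (hc : c ≠ 0) :
      Acount p i1 i2 n1 n2 j ≤ Acount p i1 i2 n1 n2 (c * j) := by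
    refine Finset.card_le_card_of_injOn
      (fun X => (X.1.image (c * ·), X.2.image (c * ·))) ?_ ?_
    · rintro ⟨X, Y⟩ h
      simp only [coe_filter, mem_product, mem_powersetCard, Set.mem_ofPred_eq, subset_erase] at h ⊢
      obtain ⟨⟨⟨⟨-, hX0⟩, hX⟩, ⟨-, hY0⟩, hY⟩, hd, hs⟩ := h
      refine ⟨⟨⟨⟨Finset.subset_univ _, ?_⟩, ?_⟩, ⟨Finset.subset_univ _, ?_⟩, ?_⟩, ?_, ?_⟩
      · simpa [hc] using hX0
      · rw [card_image_of_injective _ (hinj c hc), hX]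
      · simpa [hc] using hY0
      · rw [card_image_of_injective _ (hinj c hc), hY]
      · rw [← image_inter _ _ (hinj c hc), hd, image_empty]
      · rw [sum_image (hinj c hc).injOn, sum_image (hinj c hc).injOn]
        simp only [id] at hs ⊢
        rw [← mul_sum, ← mul_sum]
        rw [← hs]
        ring
    · rintro ⟨X, Y⟩ - ⟨X', Y'⟩ - h
      simp only [Prod.mk.injEq] at h
      exact Prod.ext (image_injective (hinj c hc) h.1) (image_injective (hinj c hc) h.2)
  refine le_antisymm ?_ ?_
  · simpa [hi] using hmaps i⁻¹ i (inv_ne_zero hi)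
  · simpa using hmaps i 1 hi

theorem sum_Acount_mul_stdAddChar (p : ℕ) [Fact p.Prime] (i1 i2 n1 n2 : ℕ) :
    ∑ i : ZMod p, (Acount p i1 i2 n1 n2 i : ℂ) * ZMod.stdAddChar i =
      Acount p i1 i2 n1 n2 0 - Acount p i1 i2 n1 n2 1 := by
  have hψ : ∑ i : ZMod p, ZMod.stdAddChar i = (0 : ℂ) := by
    refine AddChar.sum_eq_zero_of_ne_one fun h => ?_
    have := ZMod.injective_stdAddChar (N := p) (a₁ := 1) (a₂ := 0) (by simp [h])
    exact one_ne_zero this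
  rw [← add_sum_erase _ _ (mem_univ (0 : ZMod p))] at hψ ⊢
  rw [sum_congr rfl fun i hi => by
    rw [Acount_eq_of_ne_zero p i1 i2 n1 n2 i (ne_of_mem_erase hi)], ← mul_sum]
  rw [AddChar.map_zero_eq_one] at hψ ⊢
  linear_combination (Acount p i1 i2 n1 n2 1 : ℂ) * hψ

open Polynomial in
theorem prod_charFactor_eq_sum (p : ℕ) [NeZero p] (s : Finset (ZMod p)) :
    ∏ k ∈ s, charFactor p k = ∑ A ∈ s.powerset, ∑ B ∈ (s \ A).powerset,
      C (C (ZMod.stdAddChar (A.sum id + 2 * B.sum id)) * X ^ #A) * X ^ #B := by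
  have hfactor (k : ZMod p) : charFactor p k =
      C (C (ZMod.stdAddChar k) * X) + (C (C (ZMod.stdAddChar (2 * k))) * X + 1) := by
    rw [charFactor]
    ring
  have hψ (A : Finset (ZMod p)) (g : ZMod p → ZMod p) :
      ∏ k ∈ A, ZMod.stdAddChar (g k) = (ZMod.stdAddChar (∑ k ∈ A, g k) : ℂ) := by
    induction A using Finset.induction_on with
    | empty => simp
    | insert k A hk ih => rw [prod_insert hk, sum_insert hk, ih, AddChar.map_add_eq_mul]
  simp only [hfactor]
  rw [prod_add]
  refine sum_congr rfl fun A _ => ?_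
  rw [prod_add_one, mul_sum]
  refine sum_congr rfl fun B _ => ?_
  simp only [prod_mul_distrib, prod_const, ← map_prod, hψ, id, mul_sum,
    AddChar.map_add_eq_mul, map_mul, map_pow]
  ring

theorem coeff_prod_charFactor (p : ℕ) [Fact p.Prime] (n1 n2 : ℕ) :
    ((∏ k ∈ univ.erase (0 : ZMod p), charFactor p k).coeff n2).coeff n1 =
      (Acount p 1 2 n1 n2 0 : ℂ) - Acount p 1 2 n1 n2 1 := by
  rw [← sum_Acount_mul_stdAddChar]
  simp only [Acount]
  set s := univ.erase (0 : ZMod p)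
  have hsum : ∑ i : ZMod p, ((((s.powersetCard n1 ×ˢ s.powersetCard n2).filter
      (fun X => X.1 ∩ X.2 = ∅ ∧ ((1 : ℕ) : ZMod p) * X.1.sum id + ((2 : ℕ) : ZMod p) * X.2.sum id
        = i)).card : ℕ) : ℂ) * ZMod.stdAddChar i =
      ∑ X ∈ (s.powersetCard n1 ×ˢ s.powersetCard n2).filter (fun X => X.1 ∩ X.2 = ∅),
        ZMod.stdAddChar (X.1.sum id + 2 * X.2.sum id) := by
    rw [← sum_fiberwise _
      (fun X : Finset (ZMod p) × Finset (ZMod p) => X.1.sum id + 2 * X.2.sum id)]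
    refine sum_congr rfl fun i _ => ?_
    rw [filter_filter, sum_congr rfl fun X hX => by rw [(mem_filter.1 hX).2.2], sum_const,
      nsmul_eq_mul]
    simp
  rw [hsum]
  have hsdiff (A : Finset (ZMod p)) :
      (s \ A).powerset = s.powerset.filter (fun B => A ∩ B = ∅) := by
    ext B
    rw [mem_powerset, mem_filter, mem_powerset, subset_sdiff, disjoint_comm,
      disjoint_iff_inter_eq_empty]
  have hcoeff (c : ℂ) (a b : ℕ) : (((Polynomial.C (Polynomial.C c * Polynomial.X ^ a) *
      Polynomial.X ^ b).coeff n2).coeff n1 : ℂ) = if a = n1 then if b = n2 then c else 0 else 0 := by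
    rw [Polynomial.coeff_C_mul, Polynomial.coeff_X_pow, mul_ite, mul_one, mul_zero]
    simp only [eq_comm (a := n2), eq_comm (a := a)]
    split_ifs <;> simp_all [Polynomial.coeff_X_pow]
  rw [prod_charFactor_eq_sum, powersetCard_eq_filter, powersetCard_eq_filter, sum_filter,
    sum_product, sum_filter, Polynomial.finsetSum_coeff, Polynomial.finsetSum_coeff]
  refine sum_congr rfl fun A _ => ?_
  rw [hsdiff, sum_filter, sum_filter, Polynomial.finsetSum_coeff, Polynomial.finsetSum_coeff]
  by_cases hA : #A = n1
  · rw [if_pos hA]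
    refine sum_congr rfl fun B _ => ?_
    by_cases hAB : A ∩ B = ∅
    · simp only [hAB, hcoeff, hA, if_true]
    · simp [hAB]
  · rw [if_neg hA]
    refine sum_eq_zero fun B _ => ?_
    by_cases hAB : A ∩ B = ∅
    · simp only [hAB, hcoeff, hA, if_true, if_false]
    · simp [hAB]

theorem force_one_two_eq_coeff (p : ℕ) [Fact p.Prime] (n1 n2 : ℕ) (h : n1 + n2 + 2 < p) :
    (force p 1 2 (n1 + 1 : ℕ) (n2 + 1 : ℕ) : ℂ) =
      ((∏ k : ZMod p, charFactor p k).coeff (n2 + 1)).coeff (n1 + 1) := by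
  rw [← mul_prod_erase _ _ (mem_univ (0 : ZMod p))]
  have e1 : ((n1 + 1 : ℕ) : ℤ) - 1 = (n1 : ℕ) := by push_cast; ring
  have e2 : ((n2 + 1 : ℕ) : ℤ) - 1 = (n2 : ℕ) := by push_cast; ring
  have hΔ (a b : ℕ) (hab : a + b < p) : (DeltaExt p 1 2 a b : ℂ) =
      ((∏ k ∈ univ.erase (0 : ZMod p), charFactor p k).coeff b).coeff a := by
    rw [coeff_prod_charFactor, DeltaExt, if_pos (by omega)]
    simp
  rw [force, e1, e2]
  push_cast only [Int.cast_add]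
  rw [hΔ _ _ (by omega), hΔ _ _ (by omega), hΔ _ _ (by omega)]
  set G := ∏ k ∈ univ.erase (0 : ZMod p), charFactor p k
  simp [charFactor, add_mul]

/-- For positive `n1, n2` with `n1 + 2 n2 = p`,
`f^{1,2}(n1,n2,p) = (-1)^{n2} (C(p-n2, n2) + C(p-n2-1, n2-1))`. -/
theorem rarefaction_stmt16 (p : ℕ) [NeZero p] (hp : p.Prime) (hodd : Odd p)
    (n1 n2 : ℕ) (hn1 : 0 < n1) (hn2 : 0 < n2) (hsum : n1 + 2 * n2 = p) :
    force p 1 2 n1 n2 =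
      (-1) ^ n2 * ((p - n2).choose n2 + (p - n2 - 1).choose (n2 - 1)) := by
  have : Fact p.Prime := ⟨hp⟩
  obtain ⟨i, rfl⟩ : ∃ i, n1 = i + 1 := ⟨n1 - 1, by omega⟩
  obtain ⟨j, rfl⟩ : ∃ j, n2 = j + 1 := ⟨n2 - 1, by omega⟩
  have hp2 : p - (j + 1) = i + 1 + j + 1 := by omega
  have hi : Even i := by
    rw [← hsum] at hodd
    grind
  rw [hp2]
  apply Int.cast_injective (α := ℂ)
  have hforce := force_one_two_eq_coeff p i j (by omega)
  convert hforce using 1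
  rw [prod_charFactor, Polynomial.coeff_add, Polynomial.coeff_add, Polynomial.coeff_sub,
    Polynomial.coeff_sub, coeff_powerSumPoly p (i + 1) (j + 1) hsum]
  have hne : j + 1 ≠ p := by omega
  simp [Polynomial.coeff_X_pow, Polynomial.coeff_one, hne, lucasCoeff, pow_add, hi.neg_one_pow]
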